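/- arXiv:2508.06731 — 6 statements merged into one kernel-verified Lean document; each statement's English description precedes it below -/
import Mathlib

section
/- Let D be a positive integer and let G be a connected graph in which every vertex has degree at most D. Then for every finite set S of vertices of G with |S| = n, there exist at least ⌈(n−1)/D⌉ pairwise vertex-disjoint paths in G, each of which joins two distinct vertices of S. -/
/-- One step towards the root `r` along the parent function `p`. -/
def ParentStep {V : Type*} (r : V) (p : V → V) (x y : V) : Prop := x ≠ r ∧ p x = y

open Relation in
/-- A chain of parent steps is realised by a walk through vertices lying on the chain. -/
theorem ParentStep.exists_walk {V : Type*} {G : SimpleGraph V} {r : V} {p : V → V}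
    (hp : ∀ x, x ≠ r → G.Adj x (p x)) {a v : V} (h : ReflTransGen (ParentStep r p) a v) :
    ∃ w : G.Walk a v, ∀ x ∈ w.support,
      ReflTransGen (ParentStep r p) a x ∧ ReflTransGen (ParentStep r p) x v := by
  induction h using ReflTransGen.head_induction_on with
  | refl => exact ⟨.nil, fun x hx => by simp_all [ReflTransGen.refl]⟩
  | head hab hbv ih =>
    obtain ⟨w, hw⟩ := ih
    refine ⟨.cons (hab.2 ▸ hp _ hab.1) w, fun x hx => ?_⟩
    rw [SimpleGraph.Walk.support_cons, List.mem_cons] at hx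
    rcases hx with rfl | hx
    · exact ⟨.refl, .head hab hbv⟩
    · exact ⟨.head hab (hw x hx).1, (hw x hx).2⟩

open Relation in
/-- Two descendants of `v` are joined by a path of descendants of `v`, each of which is an
ancestor of one of the two ends. -/
theorem ParentStep.exists_isPath {V : Type*} {G : SimpleGraph V} {r : V} {p : V → V}
    (hp : ∀ x, x ≠ r → G.Adj x (p x)) {a b v : V} (ha : ReflTransGen (ParentStep r p) a v)
    (hb : ReflTransGen (ParentStep r p) b v) :
    ∃ w : G.Walk a b, w.IsPath ∧ ∀ x ∈ w.support,
      (ReflTransGen (ParentStep r p) a x ∨ ReflTransGen (ParentStep r p) b x) ∧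
        ReflTransGen (ParentStep r p) x v := by
  classical
  obtain ⟨w₁, h₁⟩ := ParentStep.exists_walk hp ha
  obtain ⟨w₂, h₂⟩ := ParentStep.exists_walk hp hb
  refine ⟨(w₁.append w₂.reverse).bypass, SimpleGraph.Walk.bypass_isPath _, fun x hx => ?_⟩
  have hx := SimpleGraph.Walk.support_bypass_subset_support _ hx
  rw [SimpleGraph.Walk.mem_support_append_iff, SimpleGraph.Walk.support_reverse,
    List.mem_reverse] at hx
  rcases hx with hx | hx
  · exact ⟨.inl (h₁ x hx).1, (h₁ x hx).2⟩
  · exact ⟨.inr (h₂ x hx).1, (h₂ x hx).2⟩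

open Relation in
open scoped Classical in
/-- If no child of `v` has two descendants in `S`, then `v` has at most one more descendant in
`S` than it has children. -/
theorem ParentStep.card_descendants_le {V : Type*} {r : V} {p : V → V} {v : V} (S C : Finset V)
    (hC : ∀ c, ParentStep r p c v → c ∈ C)
    (hS : ∀ c, ParentStep r p c v → ∀ a ∈ S, ∀ b ∈ S, ReflTransGen (ParentStep r p) a c →
      ReflTransGen (ParentStep r p) b c → a = b) :
    (S.filter fun x => ReflTransGen (ParentStep r p) x v).card ≤ C.card + 1 := by
  have key : ∀ x : V, ∃ c : V, ReflTransGen (ParentStep r p) x v → x ≠ v →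
      ReflTransGen (ParentStep r p) x c ∧ ParentStep r p c v := fun x => by
    by_cases h : ReflTransGen (ParentStep r p) x v
    · rcases h.cases_tail with h | ⟨c, h⟩
      · exact ⟨x, fun _ hx => absurd h.symm hx⟩
      · exact ⟨c, fun _ _ => h⟩
    · exact ⟨x, fun h' => absurd h' h⟩
  choose f hf using key
  have hle : ((S.filter fun x => ReflTransGen (ParentStep r p) x v).erase v).card ≤ C.card := by
    refine Finset.card_le_card_of_injOn f (fun x hx => ?_) (fun x hx y hy hxy => ?_)
    · simp only [Finset.coe_erase, Finset.coe_filter, Set.mem_sdiff, Set.mem_ofPred_eq,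
        Set.mem_singleton_iff] at hx
      exact hC _ (hf x hx.1.2 hx.2).2
    · simp only [Finset.coe_erase, Finset.coe_filter, Set.mem_sdiff, Set.mem_ofPred_eq,
        Set.mem_singleton_iff] at hx hy
      have h₁ := hf x hx.1.2 hx.2
      have h₂ := hf y hy.1.2 hy.2
      exact hS _ h₁.2 x hx.1.1 y hy.1.1 h₁.1 (hxy ▸ h₂.1)
  have := Finset.pred_card_le_card_erase (s := S.filter fun x => ReflTransGen (ParentStep r p) x v)
    (a := v)
  omega

open Relation in
/-- The disjoint paths can be found inside a spanning tree, given by a parent function `p` with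
root `r` and depth function `h`, using only ancestors of elements of `S`. -/
theorem ParentStep.exists_disjoint_paths {V : Type*} {G : SimpleGraph V} {r : V} {p : V → V}
    {h : V → ℕ} (hp : ∀ x, x ≠ r → G.Adj x (p x)) (hh : ∀ x, x ≠ r → h (p x) + 1 = h x)
    {D : ℕ} (hdeg : ∀ v : V, (G.neighborSet v).Finite ∧ (G.neighborSet v).ncard ≤ D)
    (S : Finset V) :
    ∃ k : ℕ, S.card ≤ k * D + 1 ∧ ∃ P : Fin k → (Σ a b : V, G.Walk a b),
      (∀ i, (P i).2.2.IsPath ∧ (P i).1 ∈ S ∧ (P i).2.1 ∈ S ∧ (P i).1 ≠ (P i).2.1) ∧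
      (∀ i, ∀ x ∈ (P i).2.2.support, ∃ s ∈ S, ReflTransGen (ParentStep r p) s x) ∧
      (∀ i j, i ≠ j → ∀ x ∈ (P i).2.2.support, x ∉ (P j).2.2.support) := by
  classical
  have hroot : ∀ n x, h x = n → ReflTransGen (ParentStep r p) x r := by
    intro n
    induction n with
    | zero =>
      intro x hx
      by_cases hxr : x = r
      · exact hxr ▸ .refl
      · have := hh x hxr
        omega
    | succ n ih =>
      intro x hx
      by_cases hxr : x = r
      · exact hxr ▸ .refl
      · have := hh x hxr
        exact .head ⟨hxr, rfl⟩ (ih (p x) (by omega))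
  have hmono : ∀ {a v}, ReflTransGen (ParentStep r p) a v → h v ≤ h a := by
    intro a v hav
    induction hav with
    | refl => exact le_rfl
    | tail _ hbc ih =>
      have := hh _ hbc.1
      rw [hbc.2] at this
      omega
  induction hn : S.card using Nat.strong_induction_on generalizing S with
  | _ n ih =>
  subst hn
  by_cases hS : S.card ≤ 1
  · exact ⟨0, by omega, fun i => i.elim0, fun i => i.elim0, fun i => i.elim0, fun i => i.elim0⟩
  obtain ⟨a₀, ha₀, b₀, hb₀, hab₀⟩ := Finset.one_lt_card.mp (not_le.mp hS)
  let B : Set V := {v | ∃ a ∈ S, ∃ b ∈ S, a ≠ b ∧ ReflTransGen (ParentStep r p) a v ∧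
    ReflTransGen (ParentStep r p) b v}
  obtain ⟨v, ⟨a, ha, b, hb, hab, hav, hbv⟩, hmin⟩ :=
    (measure fun v => S.sup h - h v).wf.has_min B
      ⟨r, a₀, ha₀, b₀, hb₀, hab₀, hroot _ _ rfl, hroot _ _ rfl⟩
  have hchild : ∀ c, ParentStep r p c v → ∀ a ∈ S, ∀ b ∈ S, ReflTransGen (ParentStep r p) a c →
      ReflTransGen (ParentStep r p) b c → a = b := by
    intro c hc a ha b hb hac hbc
    by_contra hne
    refine hmin c ⟨a, ha, b, hb, hne, hac, hbc⟩ ?_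
    change S.sup h - h c < S.sup h - h v
    have h₁ := hh c hc.1
    rw [hc.2] at h₁
    have h₂ := hmono hac
    have h₃ : h a ≤ S.sup h := Finset.le_sup ha
    omega
  obtain ⟨w, hw, hws⟩ := ParentStep.exists_isPath hp hav hbv
  have hws' : ∀ x ∈ w.support, ∃ s ∈ S, ReflTransGen (ParentStep r p) s x := fun x hx =>
    (hws x hx).1.elim (fun h => ⟨a, ha, h⟩) (fun h => ⟨b, hb, h⟩)
  have hN : (hdeg v).1.toFinset.card ≤ D := by
    rw [← Set.ncard_eq_toFinset_card _ (hdeg v).1]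
    exact (hdeg v).2
  have hCN : ∀ c, ParentStep r p c v → c ∈ (hdeg v).1.toFinset := fun c hc => by
    have := hp c hc.1
    rw [hc.2] at this
    simpa using this.symm
  by_cases hvr : v = r
  · have hle := ParentStep.card_descendants_le S _ hCN hchild
    rw [Finset.filter_true_of_mem fun x _ => hvr ▸ hroot _ x rfl] at hle
    refine ⟨1, by omega, fun _ => ⟨a, b, w⟩, fun _ => ⟨hw, ha, hb, hab⟩, fun _ => hws',
      fun i j hij => absurd (Subsingleton.elim i j) hij⟩
  have hle := ParentStep.card_descendants_le S ((hdeg v).1.toFinset.erase (p v))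
    (fun c hc => Finset.mem_erase.mpr ⟨fun hcv => by
      have h₁ := hh c hc.1
      rw [hc.2] at h₁
      have h₂ := hh v hvr
      rw [← hcv] at h₂
      omega, hCN c hc⟩) hchild
  have hpv : p v ∈ (hdeg v).1.toFinset := by simpa using hp v hvr
  have hpos := Finset.card_pos.mpr ⟨_, hpv⟩
  rw [Finset.card_erase_of_mem hpv] at hle
  have hsum := Finset.card_filter_add_card_filter_not (s := S)
    (fun x => ReflTransGen (ParentStep r p) x v)
  have hapos : 0 < (S.filter fun x => ReflTransGen (ParentStep r p) x v).card :=
    Finset.card_pos.mpr ⟨a, Finset.mem_filter.mpr ⟨ha, hav⟩⟩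
  obtain ⟨k, hk, P, hP, hPS, hPd⟩ :=
    ih _ (by omega) (S.filter fun x => ¬ ReflTransGen (ParentStep r p) x v) rfl
  have hdisj : ∀ i, ∀ x ∈ (P i).2.2.support, x ∉ w.support := by
    intro i x hx hxw
    obtain ⟨s, hs, hsx⟩ := hPS i x hx
    exact (Finset.mem_filter.mp hs).2 (hsx.trans (hws x hxw).2)
  refine ⟨k + 1, by rw [add_mul]; omega,
    Fin.cons (α := fun _ => Σ a b : V, G.Walk a b) ⟨a, b, w⟩ P, ?_, ?_, ?_⟩
  · refine Fin.cases ⟨hw, ha, hb, hab⟩ fun i => ?_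
    obtain ⟨h₁, h₂, h₃, h₄⟩ := hP i
    exact ⟨h₁, Finset.filter_subset _ _ h₂, Finset.filter_subset _ _ h₃, h₄⟩
  · refine Fin.cases hws' fun i x hx => ?_
    obtain ⟨s, hs, hsx⟩ := hPS i x hx
    exact ⟨s, Finset.filter_subset _ _ hs, hsx⟩
  · refine Fin.cases (Fin.cases (fun h => absurd rfl h) ?_) fun i => Fin.cases ?_ ?_
    · exact fun j _ x hx hx' => hdisj j x hx' hx
    · exact fun _ x hx => hdisj i x hx
    · exact fun j hij x hx => hPd i j (fun h => hij (h ▸ rfl)) x hx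

/-- In a connected graph with maximum degree at most `D`, for every finite set `S` of `n`
vertices there exist at least `⌈(n-1)/D⌉` pairwise vertex-disjoint paths, each joining two
distinct vertices of `S`. -/
theorem disjoint_paths_with_endpoints_in_set
    {V : Type*} (G : SimpleGraph V) (hconn : G.Connected)
    (D : ℕ) (hD : 0 < D)
    (hdeg : ∀ v : V, (G.neighborSet v).Finite ∧ (G.neighborSet v).ncard ≤ D)
    (S : Finset V) :
    ∃ k : ℕ, ((S.card : ℚ) - 1) / (D : ℚ) ≤ (k : ℚ) ∧
      ∃ (u v : Fin k → V) (P : ∀ i, G.Walk (u i) (v i)),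
        (∀ i, (P i).IsPath) ∧
        (∀ i, u i ∈ S) ∧ (∀ i, v i ∈ S) ∧ (∀ i, u i ≠ v i) ∧
        (∀ i j, i ≠ j → ∀ x : V, x ∈ (P i).support → x ∉ (P j).support) := by
  obtain ⟨r⟩ := hconn.nonempty
  have hpar : ∀ x, ∃ y, x ≠ r → G.Adj x y ∧ G.dist y r + 1 = G.dist x r := by
    intro x
    by_cases hx : x = r
    · exact ⟨x, fun h => absurd hx h⟩
    obtain ⟨w, hw⟩ := hconn.exists_walk_length_eq_dist x r
    cases w with
    | nil => exact absurd rfl hx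
    | @cons _ y _ hxy w =>
      refine ⟨y, fun _ => ⟨hxy, ?_⟩⟩
      rw [SimpleGraph.Walk.length_cons] at hw
      have h₁ := SimpleGraph.dist_le w
      obtain ⟨w', hw'⟩ := hconn.exists_walk_length_eq_dist y r
      have h₂ := SimpleGraph.dist_le (SimpleGraph.Walk.cons hxy w')
      rw [SimpleGraph.Walk.length_cons] at h₂
      omega
  choose p hp using hpar
  obtain ⟨k, hk, P, hP, -, hd⟩ := ParentStep.exists_disjoint_paths (h := fun x => G.dist x r)
    (fun x hx => (hp x hx).1) (fun x hx => (hp x hx).2) hdeg S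
  refine ⟨k, ?_, fun i => (P i).1, fun i => (P i).2.1, fun i => (P i).2.2, fun i => (hP i).1,
    fun i => (hP i).2.1, fun i => (hP i).2.2.1, fun i => (hP i).2.2.2, hd⟩
  rw [div_le_iff₀ (by exact_mod_cast hD), sub_le_iff_le_add]
  exact_mod_cast hk
end

section
/- Let D and m be positive integers and let G be a connected graph in which every vertex has degree at most D. Suppose S_1, …, S_m are pairwise disjoint finite subsets of V(G), each of size at least 2 + (D−1)(m−1). Then there exist pairwise vertex-disjoint paths P_1, …, P_m in G such that, for every 1 ≤ i ≤ m, both endpoints of P_i are distinct vertices of S_i. -/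
/-- `v` is an ancestor of `u` (possibly `u` itself) with respect to the parent function `p`. -/
def IsAncestor {V : Type*} (p : V → V) (v u : V) : Prop := ∃ k, p^[k] u = v

/-- `p` is the parent function of a spanning tree of `G` rooted at `r`, with depth function `d`. -/
structure IsParentFunction {V : Type*} (G : SimpleGraph V) (r : V) (p : V → V) (d : V → ℕ) :
    Prop where
  root : p r = r
  depth_root : d r = 0
  adj : ∀ v, v ≠ r → G.Adj v (p v)
  depth : ∀ v, v ≠ r → d v = d (p v) + 1

theorem IsAncestor.refl {V : Type*} (p : V → V) (v : V) : IsAncestor p v v := ⟨0, rfl⟩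

theorem IsAncestor.trans {V : Type*} {p : V → V} {u v w : V} (h : IsAncestor p u v)
    (h' : IsAncestor p v w) : IsAncestor p u w := by
  obtain ⟨a, rfl⟩ := h
  obtain ⟨b, rfl⟩ := h'
  exact ⟨a + b, Function.iterate_add_apply p a b w⟩

theorem IsAncestor.exists_child {V : Type*} {p : V → V} {v x : V} (h : IsAncestor p v x)
    (hne : x ≠ v) : ∃ c, p c = v ∧ c ≠ v ∧ IsAncestor p c x := by
  classical
  have hk := Nat.find_spec h
  have hmin := fun j => Nat.find_min h (m := j)
  generalize Nat.find h = k at hk hmin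
  cases k with
  | zero => exact absurd hk hne
  | succ k =>
    exact ⟨p^[k] x, (Function.iterate_succ_apply' p k x).symm.trans hk, hmin k k.lt_succ_self, k, rfl⟩

/-- If distinct elements of `F` never lie below a common child of `v`, then `F` has at most as
many elements strictly below `v` as `v` has children. -/
theorem IsAncestor.card_le_card_children {V : Type*} {p : V → V} {F C : Finset V} {v : V}
    (hC : ∀ c, c ∈ C ↔ p c = v ∧ c ≠ v) (hF : ∀ x ∈ F, IsAncestor p v x) (hv : v ∉ F)
    (hinj : ∀ c ∈ C, ∀ x ∈ F, ∀ y ∈ F, IsAncestor p c x → IsAncestor p c y → x = y) :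
    F.card ≤ C.card := by
  classical
  have key : ∀ x, ∃ c, x ∈ F → c ∈ C ∧ IsAncestor p c x := by
    intro x
    by_cases hx : x ∈ F
    · obtain ⟨c, hc₁, hc₂, hc₃⟩ := (hF x hx).exists_child (fun e => hv (e ▸ hx))
      exact ⟨c, fun _ => ⟨(hC c).2 ⟨hc₁, hc₂⟩, hc₃⟩⟩
    · exact ⟨v, fun h => absurd h hx⟩
  choose f hf using key
  refine Finset.card_le_card_of_injOn f (fun x hx => (hf x hx).1) fun x hx y hy hxy => ?_
  exact hinj (f x) (hf x hx).1 x hx y hy (hf x hx).2 (hxy ▸ (hf y hy).2)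

theorem SimpleGraph.Connected.exists_isParentFunction {V : Type*} {G : SimpleGraph V}
    (hG : G.Connected) (r : V) : ∃ p d, IsParentFunction G r p d := by
  classical
  have key : ∀ v, ∃ w, (v = r → w = r) ∧
      (v ≠ r → G.Adj v w ∧ G.dist v r = G.dist w r + 1) := by
    intro v
    by_cases hv : v = r
    · exact ⟨r, fun _ => rfl, fun h => absurd hv h⟩
    obtain ⟨q, hq⟩ := hG.exists_walk_length_eq_dist v r
    cases q with
    | nil => exact absurd rfl hv
    | @cons _ w _ hadj q =>
      refine ⟨w, fun h => absurd h hv, fun _ => ⟨hadj, ?_⟩⟩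
      have h₁ := SimpleGraph.dist_le q
      have h₂ := hG.dist_triangle (u := v) (v := w) (w := r)
      rw [SimpleGraph.dist_eq_one_iff_adj.2 hadj] at h₂
      rw [SimpleGraph.Walk.length_cons] at hq
      omega
  choose p hp using key
  exact ⟨p, fun v => G.dist v r, (hp r).1 rfl, by simp, fun v hv => ((hp v).2 hv).1,
    fun v hv => ((hp v).2 hv).2⟩

namespace IsParentFunction

variable {V : Type*} {G : SimpleGraph V} {r : V} {p : V → V} {d : V → ℕ}

theorem depth_le (h : IsParentFunction G r p d) {v u : V} (hvu : IsAncestor p v u) :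
    d v ≤ d u := by
  obtain ⟨k, rfl⟩ := hvu
  induction k with
  | zero => exact le_rfl
  | succ k ih =>
    rw [Function.iterate_succ_apply']
    by_cases hr : p^[k] u = r
    · rw [hr, h.root, h.depth_root]; exact Nat.zero_le _
    · have := h.depth _ hr
      omega

theorem root_isAncestor (h : IsParentFunction G r p d) (u : V) : IsAncestor p r u := by
  induction hn : d u using Nat.strong_induction_on generalizing u with
  | _ n ih =>
    by_cases hu : u = r
    · exact hu ▸ IsAncestor.refl p _
    · have := h.depth u hu
      exact (ih (d (p u)) (by omega) (p u) rfl).trans ⟨1, rfl⟩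

theorem exists_walk (h : IsParentFunction G r p d) {v x : V} (hvx : IsAncestor p v x) :
    ∃ P : G.Walk x v, ∀ w ∈ P.support, IsAncestor p v w ∧ IsAncestor p w x := by
  obtain ⟨k, rfl⟩ := hvx
  induction k generalizing x with
  | zero => exact ⟨.nil, by simp [IsAncestor.refl]⟩
  | succ k ih =>
    rw [Function.iterate_succ_apply]
    by_cases hx : x = r
    · rw [show p x = x by rw [hx, h.root]]
      exact ih
    · obtain ⟨P, hP⟩ := ih (x := p x)
      refine ⟨.cons (h.adj x hx) P, fun w hw => ?_⟩
      rw [SimpleGraph.Walk.support_cons, List.mem_cons] at hw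
      obtain rfl | hw := hw
      · exact ⟨⟨k + 1, rfl⟩, .refl p w⟩
      · exact ⟨(hP w hw).1, (hP w hw).2.trans ⟨1, rfl⟩⟩

theorem exists_path (h : IsParentFunction G r p d) {v x y : V} (hx : IsAncestor p v x)
    (hy : IsAncestor p v y) :
    ∃ P : G.Walk x y, P.IsPath ∧
      ∀ w ∈ P.support, IsAncestor p v w ∧ (IsAncestor p w x ∨ IsAncestor p w y) := by
  classical
  obtain ⟨P, hP⟩ := h.exists_walk hx
  obtain ⟨Q, hQ⟩ := h.exists_walk hy
  refine ⟨(P.append Q.reverse).bypass, SimpleGraph.Walk.bypass_isPath _, fun w hw => ?_⟩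
  have hw := SimpleGraph.Walk.support_bypass_subset_support _ hw
  rw [SimpleGraph.Walk.mem_support_append_iff, SimpleGraph.Walk.support_reverse,
    List.mem_reverse] at hw
  obtain hw | hw := hw
  · exact ⟨(hP w hw).1, .inl (hP w hw).2⟩
  · exact ⟨(hQ w hw).1, .inr (hQ w hw).2⟩

theorem ne_root_of_child (h : IsParentFunction G r p d) {c : V} (hc : c ≠ p c) : c ≠ r := by
  rintro rfl
  exact hc h.root.symm

/-- The children of `v` number at most `D`, and at most `D - 1` unless `v` is the root. -/
theorem exists_children (h : IsParentFunction G r p d) {D : ℕ} {v : V}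
    (hfin : (G.neighborSet v).Finite) (hD : (G.neighborSet v).ncard ≤ D) :
    ∃ C : Finset V, (∀ c, c ∈ C ↔ p c = v ∧ c ≠ v) ∧ C.card ≤ D ∧
      (v ≠ r → C.card ≤ D - 1) := by
  classical
  have hsub : ∀ c, p c = v → c ≠ v → c ∈ hfin.toFinset := by
    rintro c rfl hcv
    rw [Set.Finite.mem_toFinset, SimpleGraph.mem_neighborSet]
    exact (h.adj c (h.ne_root_of_child hcv)).symm
  rw [Set.ncard_eq_toFinset_card _ hfin] at hD
  refine ⟨hfin.toFinset.filter fun c => p c = v ∧ c ≠ v, fun c => ?_,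
    (Finset.card_filter_le _ _).trans hD, fun hv => ?_⟩
  · rw [Finset.mem_filter]
    exact ⟨fun hc => hc.2, fun hc => ⟨hsub c hc.1 hc.2, hc⟩⟩
  · have hpv : p v ∈ hfin.toFinset := by simpa using h.adj v hv
    have hlt : (hfin.toFinset.filter fun c => p c = v ∧ c ≠ v).card < hfin.toFinset.card := by
      refine Finset.card_lt_card (Finset.filter_ssubset.2 ⟨p v, hpv, fun hc => ?_⟩)
      have h₁ := h.depth v hv
      have h₂ := h.depth (p v) (h.ne_root_of_child (by rw [hc.1]; exact hc.2))
      rw [hc.1] at h₂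
      omega
    omega

/-- There is a deepest vertex having two descendants in a common member of the family `S`. -/
theorem exists_deepest (h : IsParentFunction G r p d) {ι : Type*} (I : Finset ι)
    (hI : I.Nonempty) (S : ι → Finset V) (hcard : ∀ i ∈ I, 2 ≤ (S i).card) :
    ∃ v, (∃ i ∈ I, ∃ x ∈ S i, ∃ y ∈ S i, x ≠ y ∧ IsAncestor p v x ∧ IsAncestor p v y) ∧
      ∀ c, d v < d c → ∀ i ∈ I, ∀ x ∈ S i, ∀ y ∈ S i,
        IsAncestor p c x → IsAncestor p c y → x = y := by
  classical
  let A : Set V :=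
    {v | ∃ i ∈ I, ∃ x ∈ S i, ∃ y ∈ S i, x ≠ y ∧ IsAncestor p v x ∧ IsAncestor p v y}
  have hA : A.Nonempty := by
    obtain ⟨i, hi⟩ := hI
    obtain ⟨x, hx, y, hy, hxy⟩ := Finset.one_lt_card.1 (hcard i hi)
    exact ⟨r, i, hi, x, hx, y, hy, hxy, h.root_isAncestor x, h.root_isAncestor y⟩
  let M := (I.biUnion S).sup d
  have hM : ∀ v ∈ A, d v ≤ M := by
    rintro v ⟨i, hi, x, hx, -, -, -, hvx, -⟩
    exact (h.depth_le hvx).trans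
      (Finset.le_sup (f := d) (Finset.mem_biUnion.2 ⟨i, hi, hx⟩))
  obtain ⟨v, hvA, hv⟩ := exists_minimalFor_of_wellFoundedLT (· ∈ A) (fun v => M - d v) hA
  refine ⟨v, hvA, fun c hc i hi x hx y hy hcx hcy => ?_⟩
  by_contra hxy
  have hcA : c ∈ A := ⟨i, hi, x, hx, y, hy, hxy, hcx, hcy⟩
  have h₁ := hM c hcA
  have h₂ := hv hcA
  simp only at h₂
  omega

/-- One can cut off a subtree, with root `v`, which contains two vertices of some `S i` but at
most `D - 1` vertices of any other member of the family. -/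
theorem exists_subtree (h : IsParentFunction G r p d) {D : ℕ}
    (hdeg : ∀ v : V, (G.neighborSet v).Finite ∧ (G.neighborSet v).ncard ≤ D)
    {ι : Type*} (I : Finset ι) (hI : I.Nonempty) (S : ι → Finset V)
    (hdisj : ∀ i ∈ I, ∀ j ∈ I, i ≠ j → Disjoint (S i) (S j))
    (hcard : ∀ i ∈ I, 2 + (D - 1) * (I.card - 1) ≤ (S i).card) :
    ∃ v, ∃ i ∈ I, (∃ x ∈ S i, ∃ y ∈ S i, x ≠ y ∧ IsAncestor p v x ∧ IsAncestor p v y) ∧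
      ∀ k ∈ I, k ≠ i → ∀ F : Finset V, (∀ x, x ∈ F ↔ x ∈ S k ∧ IsAncestor p v x) →
        F.card ≤ D - 1 := by
  classical
  obtain ⟨v, hv, hdeep⟩ := h.exists_deepest I hI S fun i hi =>
    (Nat.le_add_right _ _).trans (hcard i hi)
  obtain ⟨C, hC, hCD, hCD'⟩ := h.exists_children (hdeg v).1 (hdeg v).2
  have hchild : ∀ c ∈ C, d v < d c := by
    intro c hc
    obtain ⟨rfl, hcv⟩ := (hC c).1 hc
    have := h.depth c (h.ne_root_of_child hcv)
    omega
  have hchoice : ∃ i ∈ I, (∃ x ∈ S i, ∃ y ∈ S i, x ≠ y ∧ IsAncestor p v x ∧ IsAncestor p v y) ∧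
      ∀ k ∈ I, k ≠ i → v ∈ S k → ∀ x ∈ S k, IsAncestor p v x → x = v := by
    by_cases hex : ∃ i ∈ I, v ∈ S i ∧ ∃ x ∈ S i, x ≠ v ∧ IsAncestor p v x
    · obtain ⟨i, hi, hvi, x, hx, hxv, hvx⟩ := hex
      exact ⟨i, hi, ⟨x, hx, v, hvi, hxv, hvx, .refl p v⟩, fun k hk hki hvk =>
        absurd hvi (Finset.disjoint_left.1 (hdisj k hk i hi hki) hvk)⟩
    · obtain ⟨i, hi, hvi⟩ := hv
      refine ⟨i, hi, hvi, fun k hk _ hvk x hx hvx => ?_⟩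
      by_contra hxv
      exact hex ⟨k, hk, hvk, x, hx, hxv, hvx⟩
  obtain ⟨i, hi, hpair, hother⟩ := hchoice
  refine ⟨v, i, hi, hpair, fun k hk hki F hF => ?_⟩
  have hFC : F.card ≤ C.card := by
    by_cases hvF : v ∈ F
    · have hF1 : F ⊆ {v} := fun x hx => Finset.mem_singleton.2 <|
        hother k hk hki ((hF v).1 hvF).1 x ((hF x).1 hx).1 ((hF x).1 hx).2
      have hCne : C.Nonempty := by
        obtain ⟨x, -, y, -, hxy, hx, hy⟩ := hpair
        by_cases hxv : x = v
        · obtain ⟨c, h₁, h₂, -⟩ := hy.exists_child (fun e => hxy (hxv.trans e.symm))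
          exact ⟨c, (hC c).2 ⟨h₁, h₂⟩⟩
        · obtain ⟨c, h₁, h₂, -⟩ := hx.exists_child hxv
          exact ⟨c, (hC c).2 ⟨h₁, h₂⟩⟩
      exact (Finset.card_le_card hF1).trans (by simpa using hCne)
    · exact IsAncestor.card_le_card_children hC (fun x hx => ((hF x).1 hx).2) hvF
        fun c hc x hx y hy => hdeep c (hchild c hc) k hk x ((hF x).1 hx).1 y ((hF y).1 hy).1
  by_cases hvr : v = r
  · subst hvr
    have hFS : F = S k := by
      ext x
      rw [hF x, and_iff_left (h.root_isAncestor x)]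
    have hlt : 1 < I.card := Finset.one_lt_card.2 ⟨k, hk, i, hi, hki⟩
    have h₁ := hcard k hk
    have h₂ : (D - 1) * 1 ≤ (D - 1) * (I.card - 1) := Nat.mul_le_mul_left _ (by omega)
    rw [← hFS] at h₁
    omega
  · exact hFC.trans (hCD' hvr)

theorem exists_disjoint_paths (h : IsParentFunction G r p d) {D : ℕ}
    (hdeg : ∀ v : V, (G.neighborSet v).Finite ∧ (G.neighborSet v).ncard ≤ D)
    {ι : Type*} (I : Finset ι) (S : ι → Finset V)
    (hdisj : ∀ i ∈ I, ∀ j ∈ I, i ≠ j → Disjoint (S i) (S j))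
    (hcard : ∀ i ∈ I, 2 + (D - 1) * (I.card - 1) ≤ (S i).card) :
    ∃ W : ι → Set V,
      (∀ i ∈ I, ∃ u ∈ S i, ∃ v ∈ S i, u ≠ v ∧
        ∃ P : G.Walk u v, P.IsPath ∧ ∀ x ∈ P.support, x ∈ W i) ∧
      (∀ i ∈ I, ∀ x ∈ W i, ∃ s ∈ S i, IsAncestor p x s) ∧
      ∀ i ∈ I, ∀ j ∈ I, i ≠ j → Disjoint (W i) (W j) := by
  classical
  induction hn : I.card generalizing I S with
  | zero =>
    rw [Finset.card_eq_zero] at hn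
    subst hn
    exact ⟨fun _ => ∅, by simp, by simp, by simp⟩
  | succ n ih =>
    obtain ⟨v, i, hi, ⟨x, hx, y, hy, hxy, hvx, hvy⟩, hsmall⟩ :=
      h.exists_subtree hdeg I (Finset.card_pos.1 (by omega)) S hdisj hcard
    obtain ⟨P, hP, hPsupp⟩ := h.exists_path hvx hvy
    have hIn : (I.erase i).card = n := by rw [Finset.card_erase_of_mem hi, hn]; rfl
    obtain ⟨W, hW₁, hW₂, hW₃⟩ := ih (I.erase i) (fun k => (S k).filter fun x => ¬ IsAncestor p v x)
      (fun k hk j hj hkj => Finset.disjoint_filter_filter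
        (hdisj k (Finset.mem_of_mem_erase hk) j (Finset.mem_of_mem_erase hj) hkj))
      (fun k hk => by
        obtain ⟨hki, hkI⟩ := Finset.mem_erase.1 hk
        have h₁ := hsmall k hkI hki ((S k).filter fun x => IsAncestor p v x)
          (fun x => Finset.mem_filter)
        have h₂ := hcard k hkI
        have h₃ := Finset.card_filter_add_card_filter_not (s := S k) (fun x => IsAncestor p v x)
        have hpos : 0 < n := hIn ▸ Finset.card_pos.2 ⟨k, hk⟩
        obtain ⟨l, rfl⟩ := Nat.exists_eq_add_of_lt hpos
        rw [hn] at h₂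
        rw [hIn]
        simp only [zero_add, Nat.add_sub_cancel, mul_add, mul_one] at h₂ ⊢
        omega) hIn
    have hWv : ∀ k ∈ I, k ≠ i → Disjoint (W k) {w | IsAncestor p v w} := by
      refine fun k hk hki => Set.disjoint_left.2 fun w hw hvw => ?_
      obtain ⟨s, hs, hws⟩ := hW₂ k (Finset.mem_erase.2 ⟨hki, hk⟩) w hw
      exact (Finset.mem_filter.1 hs).2 (IsAncestor.trans hvw hws)
    have hPv : {w | w ∈ P.support} ⊆ {w | IsAncestor p v w} := fun w hw => (hPsupp w hw).1
    refine ⟨Function.update W i {w | w ∈ P.support}, fun k hk => ?_, fun k hk w hw => ?_,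
      fun k hk j hj hkj => ?_⟩
    · by_cases hki : k = i
      · subst hki
        exact ⟨x, hx, y, hy, hxy, P, hP, by simp⟩
      · obtain ⟨a, ha, b, hb, hab, Q, hQ⟩ := hW₁ k (Finset.mem_erase.2 ⟨hki, hk⟩)
        rw [Function.update_of_ne hki]
        exact ⟨a, Finset.mem_of_mem_filter a ha, b, Finset.mem_of_mem_filter b hb, hab, Q, hQ⟩
    · by_cases hki : k = i
      · subst hki
        rw [Function.update_self] at hw
        obtain hwx | hwy := (hPsupp w hw).2
        · exact ⟨x, hx, hwx⟩
        · exact ⟨y, hy, hwy⟩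
      · rw [Function.update_of_ne hki] at hw
        obtain ⟨s, hs, hws⟩ := hW₂ k (Finset.mem_erase.2 ⟨hki, hk⟩) w hw
        exact ⟨s, Finset.mem_of_mem_filter s hs, hws⟩
    · by_cases hki : k = i
      · subst hki
        rw [Function.update_self, Function.update_of_ne hkj.symm]
        exact ((hWv j hj hkj.symm).mono_right hPv).symm
      · rw [Function.update_of_ne hki]
        by_cases hji : j = i
        · subst hji
          rw [Function.update_self]
          exact (hWv k hk hki).mono_right hPv
        · rw [Function.update_of_ne hji]
          exact hW₃ k (Finset.mem_erase.2 ⟨hki, hk⟩) j (Finset.mem_erase.2 ⟨hji, hj⟩) hkj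

end IsParentFunction


/-- In a connected graph with maximum degree at most `D`, given `m` pairwise disjoint vertex
sets each of size at least `2 + (D-1)(m-1)`, there exist `m` pairwise vertex-disjoint paths
`P₁, …, P_m` such that both endpoints of `P i` are distinct vertices of `S i`. -/
theorem disjoint_paths_within_prescribed_sets
    {V : Type*} (G : SimpleGraph V) (hconn : G.Connected)
    (D m : ℕ) (hD : 0 < D) (hm : 0 < m)
    (hdeg : ∀ v : V, (G.neighborSet v).Finite ∧ (G.neighborSet v).ncard ≤ D)
    (S : Fin m → Finset V)
    (hdisj : ∀ i j, i ≠ j → Disjoint (S i) (S j))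
    (hcard : ∀ i, 2 + (D - 1) * (m - 1) ≤ (S i).card) :
    ∃ (u v : Fin m → V) (P : ∀ i, G.Walk (u i) (v i)),
      (∀ i, (P i).IsPath) ∧
      (∀ i, u i ∈ S i) ∧ (∀ i, v i ∈ S i) ∧ (∀ i, u i ≠ v i) ∧
      (∀ i j, i ≠ j → ∀ x : V, x ∈ (P i).support → x ∉ (P j).support) := by
  obtain ⟨r⟩ := hconn.nonempty
  obtain ⟨p, d, h⟩ := hconn.exists_isParentFunction r
  obtain ⟨W, hW₁, -, hW₃⟩ := h.exists_disjoint_paths hdeg Finset.univ S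
    (fun i _ j _ => hdisj i j) (fun i _ => by simpa using hcard i)
  choose u hu v hv huv P hP hPW using fun i => hW₁ i (Finset.mem_univ i)
  exact ⟨u, v, P, hP, hu, hv, huv, fun i j hij x hxi hxj =>
    Set.disjoint_left.1 (hW₃ i (Finset.mem_univ i) j (Finset.mem_univ j) hij)
      (hPW i x hxi) (hPW j x hxj)⟩
end

section
/- For every s ∈ S: (i) the induced subgraph G[V_s] is connected; (ii) every vertex at distance at most h/2 from s belongs to V_s, i.e. B(s, h/2) ⊆ V_s; and (iii) every vertex of V_s is at distance at most h from s, i.e. V_s ⊆ B(s, h). -/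
/-- In a connected graph, a vertex at distance `n + 1` from `s` has a neighbour at distance at
most `n` from `s`. -/
theorem SimpleGraph.Connected.exists_adj_dist_le {V : Type*} {G : SimpleGraph V}
    (hconn : G.Connected) {v s : V} {n : ℕ} (hd : G.dist v s = n + 1) :
    ∃ w, G.Adj v w ∧ G.dist w s ≤ n := by
  obtain ⟨p, hp⟩ := hconn.exists_walk_length_eq_dist v s
  cases p with
  | nil => simp at hd
  | cons hadj q =>
    refine ⟨_, hadj, (SimpleGraph.dist_le q).trans ?_⟩
    rw [SimpleGraph.Walk.length_cons] at hp
    omega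


/-- Voronoi cells with well-separated centers: each cell induces a connected subgraph,
contains the ball of radius `h/2` around its center, and is contained in the ball of
radius `h` around its center. -/
theorem voronoi_cell_connected_and_balls
    {V : Type*} (G : SimpleGraph V) (hconn : G.Connected) (hlf : G.LocallyFinite)
    (h : ℕ) (hpos : 0 < h) (heven : Even h)
    (S : Set V)
    (hsep : ∀ s ∈ S, ∀ s' ∈ S, s ≠ s' → h < G.dist s s')
    (hcov : ∀ v : V, ∃ s ∈ S, G.dist v s ≤ h)
    (ℓ : V → ℝ) (hℓ : ∀ s ∈ S, 0 ≤ ℓ s ∧ ℓ s ≤ 1 / 2)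
    (𝒱 : V → V) (h𝒱S : ∀ v, 𝒱 v ∈ S)
    (h𝒱min : ∀ v : V, ∀ s ∈ S, s ≠ 𝒱 v →
      (G.dist v (𝒱 v) : ℝ) + ℓ (𝒱 v) < (G.dist v s : ℝ) + ℓ s) :
    ∀ s ∈ S,
      (G.induce {v | 𝒱 v = s}).Connected ∧
      (∀ v : V, G.dist s v ≤ h / 2 → 𝒱 v = s) ∧
      (∀ v : V, 𝒱 v = s → G.dist s v ≤ h) := by
  have ball : ∀ s ∈ S, ∀ v : V, G.dist s v ≤ h / 2 → 𝒱 v = s := by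
    intro s hs v hv
    by_contra hne
    have hmin := h𝒱min v s hs (Ne.symm hne)
    have hfar := hsep s hs _ (h𝒱S v) (Ne.symm hne)
    have htri := hconn.dist_triangle (u := s) (v := v) (w := 𝒱 v)
    rw [G.dist_comm (u := v) (v := s)] at hmin
    have hlt : G.dist s v + 1 ≤ G.dist v (𝒱 v) := by omega
    have hltR : (G.dist s v : ℝ) + 1 ≤ G.dist v (𝒱 v) := by exact_mod_cast hlt
    linarith [(hℓ s hs).2, (hℓ _ (h𝒱S v)).1]
  have self : ∀ s ∈ S, 𝒱 s = s := fun s hs => ball s hs s (by simp)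
  intro s hs
  refine ⟨?_, ball s hs, ?_⟩
  · have reach : ∀ n : ℕ, ∀ v (hv : 𝒱 v = s), G.dist v s = n →
        (G.induce {v | 𝒱 v = s}).Reachable ⟨v, hv⟩ ⟨s, self s hs⟩ := by
      intro n
      induction n using Nat.strong_induction_on with
      | _ n ih =>
        intro v hv hd
        cases n with
        | zero =>
          obtain rfl := hconn.dist_eq_zero_iff.mp hd
          exact SimpleGraph.Reachable.refl _
        | succ n =>
          obtain ⟨w, hvw, hw⟩ := hconn.exists_adj_dist_le hd
          have hws : 𝒱 w = s := by
            by_contra hne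
            have hminw := h𝒱min w s hs (Ne.symm hne)
            have hminv := h𝒱min v (𝒱 w) (h𝒱S w) (by rwa [hv])
            have htri := hconn.dist_triangle (u := v) (v := w) (w := 𝒱 w)
            rw [SimpleGraph.dist_eq_one_iff_adj.mpr hvw] at htri
            rw [hv, hd] at hminv
            have htriR : (G.dist v (𝒱 w) : ℝ) ≤ 1 + G.dist w (𝒱 w) := by exact_mod_cast htri
            have hwR : (G.dist w s : ℝ) ≤ n := by exact_mod_cast hw
            push_cast at hminv
            linarith
          have hadj : (G.induce {v | 𝒱 v = s}).Adj ⟨v, hv⟩ ⟨w, hws⟩ := hvw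
          exact hadj.reachable.trans (ih _ (Nat.lt_succ_of_le hw) w hws rfl)
    exact SimpleGraph.connected_iff_exists_forall_reachable _ |>.mpr
      ⟨⟨s, self s hs⟩, fun v => (reach _ v.1 v.2 rfl).symm⟩
  · rintro v rfl
    obtain ⟨t, ht, htd⟩ := hcov v
    rw [G.dist_comm]
    by_cases hne : t = 𝒱 v
    · rwa [← hne]
    · have hmin := h𝒱min v t ht hne
      have htR : (G.dist v t : ℝ) ≤ h := by exact_mod_cast htd
      have hltR : (G.dist v (𝒱 v) : ℝ) < h + 1 := by
        linarith [(hℓ t ht).2, (hℓ _ (h𝒱S v)).1]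
      exact Nat.lt_succ_iff.mp (by exact_mod_cast hltR)
end

section
/- For every s ∈ S, every vertex v ∈ V_s, and every shortest path P in G from s to v, all vertices of P belong to V_s. -/
/-- Every shortest path from a Voronoi center `s` to a vertex of the cell `V_s` stays
entirely within `V_s`. -/
theorem voronoi_cell_geodesically_convex_from_center
    {V : Type*} (G : SimpleGraph V) (hconn : G.Connected) (hlf : G.LocallyFinite)
    (h : ℕ) (hpos : 0 < h) (heven : Even h)
    (S : Set V)
    (hsep : ∀ s ∈ S, ∀ s' ∈ S, s ≠ s' → h < G.dist s s')
    (hcov : ∀ v : V, ∃ s ∈ S, G.dist v s ≤ h)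
    (ℓ : V → ℝ) (hℓ : ∀ s ∈ S, 0 ≤ ℓ s ∧ ℓ s ≤ 1 / 2)
    (𝒱 : V → V) (h𝒱S : ∀ v, 𝒱 v ∈ S)
    (h𝒱min : ∀ v : V, ∀ s ∈ S, s ≠ 𝒱 v →
      (G.dist v (𝒱 v) : ℝ) + ℓ (𝒱 v) < (G.dist v s : ℝ) + ℓ s) :
    ∀ s ∈ S, ∀ v : V, 𝒱 v = s →
      ∀ P : G.Walk s v, P.IsPath → P.length = G.dist s v →
        ∀ x ∈ P.support, 𝒱 x = s := by
  classical
  intro s hs v hv P _ hlen x hx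
  by_contra hne
  have hx_min := h𝒱min x s hs (Ne.symm hne)
  have hv_min := h𝒱min v (𝒱 x) (h𝒱S x) (hv ▸ hne)
  rw [hv] at hv_min
  have hsplit : G.dist v x + G.dist x s ≤ G.dist v s := by
    have hlength := congrArg SimpleGraph.Walk.length (P.take_spec hx)
    rw [SimpleGraph.Walk.length_append] at hlength
    have hsx := SimpleGraph.dist_le (P.takeUntil x hx)
    have hxv := SimpleGraph.dist_le (P.dropUntil x hx)
    rw [G.dist_comm (u := v) (v := x), G.dist_comm (u := x) (v := s),
      G.dist_comm (u := v) (v := s)]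
    lia
  have htri : G.dist v (𝒱 x) ≤ G.dist v x + G.dist x (𝒱 x) := hconn.dist_triangle
  have hsplit_real : (G.dist v x : ℝ) + G.dist x s ≤ G.dist v s := mod_cast hsplit
  have htri_real : (G.dist v (𝒱 x) : ℝ) ≤ G.dist v x + G.dist x (𝒱 x) := mod_cast htri
  linarith
end

section
/- Let D be a positive integer, α > 0 a real number, and G a graph in which every vertex has degree at most D. Suppose that every finite nonempty set K of vertices of G satisfies |∂_in K| ≥ α|K|. Then for every vertex v of G and every natural number k, the ball B(v,k) satisfies |B(v,k)| ≥ (1 + α/D)^k. -/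
namespace SimpleGraph

variable {V : Type*} (G : SimpleGraph V)

/-- The vertices reachable within `k + 1` steps are those reachable within `k` steps together with
their neighbours. -/
theorem setOf_walk_length_le_succ (v : V) (k : ℕ) :
    {u : V | ∃ p : G.Walk v u, p.length ≤ k + 1} =
      {u : V | ∃ p : G.Walk v u, p.length ≤ k} ∪
        ⋃ w ∈ {u : V | ∃ p : G.Walk v u, p.length ≤ k}, G.neighborSet w := by
  ext u
  simp only [Set.mem_ofPred_eq, Set.mem_union, Set.mem_iUnion, mem_neighborSet, exists_prop]
  constructor
  · rintro ⟨p, hp⟩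
    obtain ⟨q, rfl⟩ : ∃ q : G.Walk u v, p = q.reverse := ⟨p.reverse, by simp⟩
    cases q with
    | nil => exact Or.inl ⟨Walk.nil, by simp⟩
    | cons h q => exact Or.inr ⟨_, ⟨q.reverse, by simpa using hp⟩, h.symm⟩
  · rintro (⟨p, hp⟩ | ⟨w, ⟨p, hp⟩, h⟩)
    · exact ⟨p, by lia⟩
    · exact ⟨p.concat h, by simpa using hp⟩

theorem finite_setOf_walk_length_le (hfin : ∀ v, (G.neighborSet v).Finite) (v : V) (k : ℕ) :
    {u : V | ∃ p : G.Walk v u, p.length ≤ k}.Finite := by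
  induction k with
  | zero =>
    refine (Set.finite_singleton v).subset ?_
    rintro u ⟨p, hp⟩
    exact (Walk.eq_of_length_eq_zero (Nat.le_zero.mp hp)).symm
  | succ k ih =>
    rw [setOf_walk_length_le_succ]
    exact ih.union (ih.biUnion fun w _ => hfin w)

/-- If `L` is finite and contains every neighbour of `K`, then the inner vertex boundary of `K` is
covered by the neighbourhoods of the vertices of `L \ K`. -/
theorem ncard_inner_boundary_le {D : ℕ}
    (hdeg : ∀ v : V, (G.neighborSet v).Finite ∧ (G.neighborSet v).ncard ≤ D)
    {K L : Set V} (hL : L.Finite) (hKL : ∀ v ∈ K, G.neighborSet v ⊆ L) :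
    {v ∈ K | ∃ u : V, G.Adj v u ∧ u ∉ K}.ncard ≤ D * (L \ K).ncard := by
  classical
  have hfin : (L \ K).Finite := hL.sdiff
  let N : V → Finset V := fun u => (hdeg u).1.toFinset
  have hsub : {v ∈ K | ∃ u : V, G.Adj v u ∧ u ∉ K} ⊆ (hfin.toFinset.biUnion N : Set V) := by
    rintro v ⟨hv, u, huv, hu⟩
    simp only [Finset.coe_biUnion, Set.mem_iUnion]
    exact ⟨u, by simpa using ⟨hKL v hv huv, hu⟩, by simpa [N] using huv.symm⟩
  calc _ ≤ (hfin.toFinset.biUnion N : Set V).ncard :=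
        Set.ncard_le_ncard hsub (Finset.finite_toSet _)
    _ = (hfin.toFinset.biUnion N).card := Set.ncard_coe_finset _
    _ ≤ hfin.toFinset.card * D := Finset.card_biUnion_le_card_mul _ _ _ fun u _ => by
        rw [← Set.ncard_eq_toFinset_card _ (hdeg u).1]
        exact (hdeg u).2
    _ = D * (L \ K).ncard := by rw [Set.ncard_eq_toFinset_card _ hfin, mul_comm]

end SimpleGraph


/-- In a graph of maximum degree at most `D` in which every finite nonempty vertex set `K`
satisfies `|∂_in K| ≥ α |K|`, every ball of radius `k` has at least `(1 + α/D)^k` vertices. -/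
theorem ball_growth_of_expansion
    {V : Type*} (G : SimpleGraph V) (D : ℕ) (hD : 0 < D) (α : ℝ) (hα : 0 < α)
    (hdeg : ∀ v : V, (G.neighborSet v).Finite ∧ (G.neighborSet v).ncard ≤ D)
    (hexp : ∀ K : Set V, K.Finite → K.Nonempty →
      α * K.ncard ≤ ({v ∈ K | ∃ u : V, G.Adj v u ∧ u ∉ K}.ncard : ℝ)) :
    ∀ (v : V) (k : ℕ),
      (1 + α / D) ^ k ≤ ({u : V | ∃ p : G.Walk v u, p.length ≤ k}.ncard : ℝ) := by
  intro v k
  have hfin := G.finite_setOf_walk_length_le (fun v => (hdeg v).1) v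
  have hD' : (0 : ℝ) < D := by exact_mod_cast hD
  induction k with
  | zero =>
    have hne : {u : V | ∃ p : G.Walk v u, p.length ≤ 0}.Nonempty :=
      ⟨v, SimpleGraph.Walk.nil, by simp⟩
    have := (Set.ncard_pos (hfin 0)).mpr hne
    rw [pow_zero]
    exact_mod_cast this
  | succ k ih =>
    have hstep := G.setOf_walk_length_le_succ v k
    have hfin' := hfin (k + 1)
    have hexpK := hexp _ (hfin k) ⟨v, SimpleGraph.Walk.nil, by simp⟩
    generalize {u : V | ∃ p : G.Walk v u, p.length ≤ k} = K at *
    generalize {u : V | ∃ p : G.Walk v u, p.length ≤ k + 1} = L at *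
    have hKL : K ⊆ L := hstep ▸ Set.subset_union_left
    have hNL : ∀ w ∈ K, G.neighborSet w ⊆ L := fun w hw =>
      hstep ▸ (Set.subset_biUnion_of_mem (u := G.neighborSet) hw).trans Set.subset_union_right
    have hbd : ({v ∈ K | ∃ u : V, G.Adj v u ∧ u ∉ K}.ncard : ℝ) ≤ D * (L \ K).ncard := by
      exact_mod_cast G.ncard_inner_boundary_le hdeg hfin' hNL
    have hcard : ((L \ K).ncard : ℝ) + K.ncard = L.ncard := by
      exact_mod_cast Set.ncard_sdiff_add_ncard_of_subset hKL hfin'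
    have hgrow : α / D * K.ncard ≤ (L \ K).ncard := by
      rw [div_mul_eq_mul_div, div_le_iff₀' hD']
      exact hexpK.trans hbd
    calc (1 + α / D) ^ (k + 1) = (1 + α / D) ^ k * (1 + α / D) := pow_succ _ _
      _ ≤ K.ncard * (1 + α / D) := by gcongr
      _ ≤ L.ncard := by linarith
end

section
/- Let G be a connected, locally finite graph whose automorphism group Aut(G) has only finitely many orbits on the vertex set V(G). Then there exists a natural number r such that for all vertices u, v of G the following are equivalent: (a) some automorphism of G maps u to v; (b) there is a graph isomorphism from the induced subgraph G[B(u,r)] to the induced subgraph G[B(v,r)] mapping u to v. -/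
open Filter

namespace SimpleGraph

variable {V : Type*} {G : SimpleGraph V}

/-- The ball of radius `r` around `u`. -/
def walkBall (G : SimpleGraph V) (u : V) (r : ℕ) : Set V :=
  {x | ∃ p : G.Walk u x, p.length ≤ r}

lemma mem_walkBall_self (u : V) (r : ℕ) : u ∈ G.walkBall u r :=
  ⟨Walk.nil, Nat.zero_le r⟩

lemma walkBall_mono (u : V) {k r : ℕ} (h : k ≤ r) : G.walkBall u k ⊆ G.walkBall u r :=
  fun _ ⟨p, hp⟩ ↦ ⟨p, hp.trans h⟩

lemma walkBall_zero (u : V) : G.walkBall u 0 = {u} := by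
  ext x
  constructor
  · rintro ⟨p, hp⟩
    exact (Walk.eq_of_length_eq_zero (Nat.le_zero.mp hp)).symm
  · rintro rfl
    exact mem_walkBall_self x 0

lemma mem_walkBall_succ {u x : V} {r : ℕ} :
    x ∈ G.walkBall u (r + 1) ↔ x ∈ G.walkBall u r ∨ ∃ y ∈ G.walkBall u r, G.Adj y x := by
  constructor
  · rintro ⟨p, hp⟩
    obtain ⟨q, hq⟩ : ∃ q : G.Walk x u, q.length = p.length := ⟨p.reverse, p.length_reverse⟩
    cases q with
    | nil => exact Or.inl (mem_walkBall_self _ _)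
    | cons h q =>
      rw [Walk.length_cons] at hq
      exact Or.inr ⟨_, ⟨q.reverse, by rw [Walk.length_reverse]; omega⟩, h.symm⟩
  · rintro (h | ⟨y, ⟨p, hp⟩, h⟩)
    · exact walkBall_mono u (Nat.le_succ r) h
    · exact ⟨p.concat h, by rw [Walk.length_concat]; omega⟩

lemma walkBall_finite (hlf : G.LocallyFinite) (u : V) (r : ℕ) : (G.walkBall u r).Finite := by
  induction r with
  | zero => rw [walkBall_zero]; exact Set.finite_singleton u
  | succ r ih =>
    have hN : (⋃ y ∈ G.walkBall u r, G.neighborSet y).Finite := ih.biUnion fun y _ ↦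
      have := hlf y
      Set.toFinite _
    refine (ih.union hN).subset fun x hx ↦ ?_
    rcases mem_walkBall_succ.mp hx with h | ⟨y, hy, h⟩
    · exact Or.inl h
    · exact Or.inr (Set.mem_biUnion hy h)

/-- The map `f` restricts to a graph homomorphism on the ball of radius `r` around `u`, sending
`u` to `v`. -/
def IsBallHom (G : SimpleGraph V) (r : ℕ) (u v : V) (f : V → V) : Prop :=
  f u = v ∧ ∀ x ∈ G.walkBall u r, ∀ y ∈ G.walkBall u r, G.Adj x y → G.Adj (f x) (f y)

lemma IsBallHom.mapsTo {r k : ℕ} {u v : V} {f : V → V} (hf : G.IsBallHom r u v f) (hk : k ≤ r) :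
    Set.MapsTo f (G.walkBall u k) (G.walkBall v k) := by
  induction k with
  | zero =>
    rw [walkBall_zero, walkBall_zero]
    rintro x rfl
    exact hf.1
  | succ k ih =>
    have ih := ih (by omega)
    intro x hx
    rcases mem_walkBall_succ.mp hx with h | ⟨y, hy, h⟩
    · exact mem_walkBall_succ.mpr (Or.inl (ih h))
    · exact mem_walkBall_succ.mpr (Or.inr ⟨f y, ih hy,
        hf.2 y (walkBall_mono u (by omega) hy) x (walkBall_mono u hk hx) h⟩)

lemma IsBallHom.mono {r k : ℕ} {u v : V} {f : V → V} (hf : G.IsBallHom r u v f) (hk : k ≤ r) :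
    G.IsBallHom k u v f :=
  ⟨hf.1, fun x hx y hy ↦ hf.2 x (walkBall_mono u hk hx) y (walkBall_mono u hk hy)⟩

lemma IsBallHom.comp {r : ℕ} {u v w : V} {f g : V → V} (hg : G.IsBallHom r v w g)
    (hf : G.IsBallHom r u v f) : G.IsBallHom r u w (g ∘ f) :=
  ⟨by simp [hf.1, hg.1], fun x hx y hy h ↦
    hg.2 _ (hf.mapsTo le_rfl hx) _ (hf.mapsTo le_rfl hy) (hf.2 x hx y hy h)⟩

lemma Iso.isBallHom (φ : G ≃g G) (r : ℕ) (u : V) : G.IsBallHom r u (φ u) φ :=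
  ⟨rfl, fun _ _ _ _ h ↦ φ.map_adj_iff.mpr h⟩

/-- The maps `f` and `g` restrict to mutually inverse rooted isomorphisms between the balls of
radius `r` around `u` and `v`. -/
structure IsBallIso (G : SimpleGraph V) (r : ℕ) (u v : V) (f g : V → V) : Prop where
  hom : G.IsBallHom r u v f
  inv : G.IsBallHom r v u g
  left_inv : Set.LeftInvOn g f (G.walkBall u r)
  right_inv : Set.LeftInvOn f g (G.walkBall v r)

lemma IsBallIso.mono {r k : ℕ} {u v : V} {f g : V → V} (h : G.IsBallIso r u v f g) (hk : k ≤ r) :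
    G.IsBallIso k u v f g :=
  ⟨h.hom.mono hk, h.inv.mono hk, h.left_inv.mono (walkBall_mono u hk),
    h.right_inv.mono (walkBall_mono v hk)⟩

lemma IsBallIso.symm {r : ℕ} {u v : V} {f g : V → V} (h : G.IsBallIso r u v f g) :
    G.IsBallIso r v u g f :=
  ⟨h.inv, h.hom, h.right_inv, h.left_inv⟩

lemma IsBallIso.trans {r : ℕ} {u v w : V} {f g f' g' : V → V} (h : G.IsBallIso r u v f g)
    (h' : G.IsBallIso r v w f' g') : G.IsBallIso r u w (f' ∘ f) (g ∘ g') :=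
  ⟨h'.hom.comp h.hom, h.inv.comp h'.inv, h.left_inv.comp h'.left_inv (h.hom.mapsTo le_rfl),
    h'.right_inv.comp h.right_inv (h'.inv.mapsTo le_rfl)⟩

lemma Iso.isBallIso (φ : G ≃g G) (r : ℕ) (u : V) : G.IsBallIso r u (φ u) φ φ.symm where
  hom := φ.isBallHom r u
  inv := by simpa using φ.symm.isBallHom r (φ u)
  left_inv x _ := φ.symm_apply_apply x
  right_inv x _ := φ.apply_symm_apply x

/-- Mutually inverse maps between balls give an isomorphism of the induced subgraphs. -/
def IsBallIso.toIso {r : ℕ} {u v : V} {f g : V → V} (h : G.IsBallIso r u v f g) :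
    G.induce (G.walkBall u r) ≃g G.induce (G.walkBall v r) where
  toFun x := ⟨f x, h.hom.mapsTo le_rfl x.2⟩
  invFun y := ⟨g y, h.inv.mapsTo le_rfl y.2⟩
  left_inv x := Subtype.ext (h.left_inv x.2)
  right_inv y := Subtype.ext (h.right_inv y.2)
  map_rel_iff' {x y} := by
    refine ⟨fun hxy ↦ ?_, fun hxy ↦ h.hom.2 x x.2 y y.2 hxy⟩
    have := h.inv.2 _ (h.hom.mapsTo le_rfl x.2) _ (h.hom.mapsTo le_rfl y.2) hxy
    rwa [h.left_inv x.2, h.left_inv y.2] at this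

open Classical in
lemma exists_isBallIso_of_iso {r : ℕ} {u v : V}
    (ψ : G.induce (G.walkBall u r) ≃g G.induce (G.walkBall v r))
    (hψ : (ψ ⟨u, mem_walkBall_self u r⟩ : V) = v) : ∃ f g, G.IsBallIso r u v f g := by
  have hψ' : ψ.symm ⟨v, mem_walkBall_self v r⟩ = ⟨u, mem_walkBall_self u r⟩ := by
    rw [RelIso.symm_apply_eq]
    exact Subtype.ext hψ.symm
  refine ⟨fun x ↦ if hx : x ∈ G.walkBall u r then ψ ⟨x, hx⟩ else x,
    fun y ↦ if hy : y ∈ G.walkBall v r then ψ.symm ⟨y, hy⟩ else y, ⟨?_, ?_⟩, ⟨?_, ?_⟩, ?_, ?_⟩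
  · simpa [mem_walkBall_self] using hψ
  · intro x hx y hy h
    simp only [hx, hy, dif_pos]
    exact ψ.map_adj_iff.mpr h
  · simp [mem_walkBall_self, hψ']
  · intro x hx y hy h
    simp only [hx, hy, dif_pos]
    exact ψ.symm.map_adj_iff.mpr h
  · intro x hx
    simp [hx]
  · intro x hx
    simp [hx]

lemma exists_forall_eventually_eq (hlf : G.LocallyFinite) (hconn : G.Connected) {u v : V}
    {f : ℕ → V → V} (hf : ∀ n, G.IsBallHom n u v (f n)) (F : Ultrafilter ℕ)
    (hF : (F : Filter ℕ) ≤ atTop) : ∃ l : V → V, ∀ x, ∀ᶠ n in F, f n x = l x := by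
  refine Classical.axiom_of_choice (r := fun x y ↦ ∀ᶠ n in F, f n x = y) fun x ↦ ?_
  obtain ⟨p⟩ := hconn.preconnected u x
  have hmem : ∀ᶠ n in F, ∃ y ∈ G.walkBall v p.length, f n x = y :=
    Eventually.filter_mono hF <| (eventually_ge_atTop p.length).mono fun n hn ↦
      ⟨_, (hf n).mapsTo hn ⟨p, le_rfl⟩, rfl⟩
  obtain ⟨y, -, hy⟩ := (Ultrafilter.eventually_exists_mem_iff (walkBall_finite hlf v _)).mp hmem
  exact ⟨y, hy⟩

lemma eventually_mem_walkBall (hconn : G.Connected) (u x : V) :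
    ∀ᶠ n in atTop, x ∈ G.walkBall u n := by
  obtain ⟨p⟩ := hconn.preconnected u x
  exact (eventually_ge_atTop p.length).mono fun n hn ↦ ⟨p, hn⟩

/-- A connected locally finite graph has an automorphism mapping `u` to `v` as soon as the balls of
all radii around `u` and `v` are isomorphic as rooted graphs. -/
lemma exists_iso_of_forall_isBallIso (hlf : G.LocallyFinite) (hconn : G.Connected) {u v : V}
    (h : ∀ n, ∃ f g, G.IsBallIso n u v f g) : ∃ φ : G ≃g G, φ u = v := by
  choose f g h using h
  have hF : (hyperfilter ℕ : Filter ℕ) ≤ atTop := Nat.hyperfilter_le_atTop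
  obtain ⟨l, hl⟩ := exists_forall_eventually_eq hlf hconn (fun n ↦ (h n).hom) _ hF
  obtain ⟨m, hm⟩ := exists_forall_eventually_eq hlf hconn (fun n ↦ (h n).inv) _ hF
  have hu x := Eventually.filter_mono hF (eventually_mem_walkBall hconn u x)
  have hv x := Eventually.filter_mono hF (eventually_mem_walkBall hconn v x)
  have hml x : m (l x) = x := by
    obtain ⟨n, h₁, h₂, h₃⟩ := ((hl x).and ((hm (l x)).and (hu x))).exists
    rw [← h₂, ← h₁, (h n).left_inv h₃]
  have hlm x : l (m x) = x := by
    obtain ⟨n, h₁, h₂, h₃⟩ := ((hm x).and ((hl (m x)).and (hv x))).exists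
    rw [← h₂, ← h₁, (h n).right_inv h₃]
  have hadj {x y} (hxy : G.Adj x y) : G.Adj (l x) (l y) := by
    obtain ⟨n, h₁, h₂, h₃, h₄⟩ := ((hl x).and ((hl y).and ((hu x).and (hu y)))).exists
    rw [← h₁, ← h₂]
    exact (h n).hom.2 x h₃ y h₄ hxy
  have hadj' {x y} (hxy : G.Adj x y) : G.Adj (m x) (m y) := by
    obtain ⟨n, h₁, h₂, h₃, h₄⟩ := ((hm x).and ((hm y).and ((hv x).and (hv y)))).exists
    rw [← h₁, ← h₂]
    exact (h n).inv.2 x h₃ y h₄ hxy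
  refine ⟨⟨⟨l, m, hml, hlm⟩, fun {x y} ↦ ⟨fun hxy ↦ ?_, hadj⟩⟩, ?_⟩
  · simpa [hml] using hadj' hxy
  · obtain ⟨n, hn⟩ := (hl u).exists
    exact hn.symm.trans (h n).hom.1

end SimpleGraph

open SimpleGraph in

/-- In a connected, locally finite, quasi-transitive graph there is a radius `r` such that two
vertices lie in the same `Aut(G)`-orbit if and only if their balls of radius `r` are isomorphic
as rooted induced subgraphs. -/
theorem orbit_iff_ball_isomorphic_of_quasiTransitive
    {V : Type*} (G : SimpleGraph V) (hconn : G.Connected) (hlf : G.LocallyFinite)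
    (horb : ∃ T : Finset V, ∀ v : V, ∃ u ∈ T, ∃ φ : G ≃g G, φ u = v) :
    ∃ r : ℕ, ∀ u v : V,
      (∃ φ : G ≃g G, φ u = v) ↔
      ∃ ψ : (G.induce {x : V | ∃ p : G.Walk u x, p.length ≤ r}) ≃g
            (G.induce {x : V | ∃ p : G.Walk v x, p.length ≤ r}),
        (ψ ⟨u, ⟨SimpleGraph.Walk.nil, Nat.zero_le r⟩⟩ : V) = v := by
  obtain ⟨T, hT⟩ := horb
  have hex (p : V × V) : ∃ r, (∃ f g, G.IsBallIso r p.1 p.2 f g) → ∃ φ : G ≃g G, φ p.1 = p.2 := by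
    by_cases h : ∀ r, ∃ f g, G.IsBallIso r p.1 p.2 f g
    · exact ⟨0, fun _ ↦ exists_iso_of_forall_isBallIso hlf hconn h⟩
    · obtain ⟨r, hr⟩ := not_forall.mp h
      exact ⟨r, fun h ↦ absurd h hr⟩
  choose R hR using hex
  refine ⟨(T ×ˢ T).sup R, fun u v ↦ ⟨?_, ?_⟩⟩
  · rintro ⟨φ, rfl⟩
    exact ⟨(φ.isBallIso _ u).toIso, rfl⟩
  · rintro ⟨ψ, hψ⟩
    obtain ⟨f, g, hfg⟩ := exists_isBallIso_of_iso ψ hψ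
    obtain ⟨s, hs, α, rfl⟩ := hT u
    obtain ⟨t, ht, β, rfl⟩ := hT v
    have hst := ((α.isBallIso _ s).trans hfg).trans (β.isBallIso _ t).symm
    obtain ⟨φ, hφ⟩ := hR (s, t)
      ⟨_, _, hst.mono (Finset.le_sup (f := R) (Finset.mk_mem_product hs ht))⟩
    exact ⟨(α.symm.trans φ).trans β, by simpa using hφ⟩
end
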